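/- arXiv:2505.01704 — 2 statements merged into one kernel-verified Lean document; each statement's English description precedes it below -/
import Mathlib

section
/- Let K̂₁(x) = x K₁(x). For every M > 0, the integral ∫₀^M [1/(K₀(√(ε + y²)) · (ε + y²))] · ( K̂₁(√(ε + y²))/K₀(√(ε + y²)) − K̂₁(y)/K₀(y) ) · y K₀(y)² dy is nonnegative for every ε > 0 and converges to 0 as ε → 0+. -/
open MeasureTheory Filter Set Topology

/-- Macdonald function `K₀`, via its integral representation. -/
noncomputable def K0 (x : ℝ) : ℝ := ∫ t in Set.Ioi (0 : ℝ), Real.exp (-x * Real.cosh t)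

/-- Macdonald function `K₁`, via its integral representation. -/
noncomputable def K1 (x : ℝ) : ℝ :=
  ∫ t in Set.Ioi (0 : ℝ), Real.exp (-x * Real.cosh t) * Real.cosh t

/-- `K̂₁(x) = x K₁(x)`. -/
noncomputable def hatK1 (x : ℝ) : ℝ := x * K1 x

/-- The moments `∫₀^∞ exp(-x cosh t) cosh^n t dt`; `K0` and `K1` are the cases `n = 0, 1`. -/
noncomputable def coshMoment (n : ℕ) (x : ℝ) : ℝ :=
  ∫ t in Set.Ioi (0 : ℝ), Real.exp (-x * Real.cosh t) * Real.cosh t ^ n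

theorem K0_eq_coshMoment : K0 = coshMoment 0 := by
  funext x; simp [K0, coshMoment]

theorem K1_eq_coshMoment : K1 = coshMoment 1 := by
  funext x; simp [K1, coshMoment]

theorem tendsto_sinh_atTop : Tendsto Real.sinh atTop atTop :=
  tendsto_atTop_mono' atTop
    ((eventually_ge_atTop 0).mono fun _ ht => Real.self_le_sinh_iff.2 ht) tendsto_id

theorem hasDerivAt_neg_exp_neg_mul_sinh {x : ℝ} (hx : x ≠ 0) (t : ℝ) :
    HasDerivAt (fun t => -(Real.exp (-x * Real.sinh t) / x))
      (Real.exp (-x * Real.sinh t) * Real.cosh t) t := by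
  have h := ((((Real.hasDerivAt_sinh t).const_mul (-x)).exp).div_const x).neg
  refine h.congr_deriv ?_
  field_simp

theorem tendsto_neg_exp_neg_mul_sinh {x : ℝ} (hx : 0 < x) :
    Tendsto (fun t => -(Real.exp (-x * Real.sinh t) / x)) atTop (𝓝 0) := by
  have h : Tendsto (fun t => -x * Real.sinh t) atTop atBot :=
    tendsto_sinh_atTop.const_mul_atTop_of_neg (by linarith)
  simpa using ((Real.tendsto_exp_atBot.comp h).div_const x).neg

theorem integrableOn_exp_neg_mul_sinh_mul_cosh {x : ℝ} (hx : 0 < x) :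
    IntegrableOn (fun t => Real.exp (-x * Real.sinh t) * Real.cosh t) (Ioi 0) :=
  integrableOn_Ioi_deriv_of_nonneg'
    (fun t _ => hasDerivAt_neg_exp_neg_mul_sinh hx.ne' t)
    (fun t _ => mul_nonneg (Real.exp_pos _).le (Real.cosh_pos t).le)
    (tendsto_neg_exp_neg_mul_sinh hx)

theorem integral_exp_neg_mul_sinh_mul_cosh {x : ℝ} (hx : 0 < x) :
    ∫ t in Ioi (0 : ℝ), Real.exp (-x * Real.sinh t) * Real.cosh t = 1 / x := by
  rw [integral_Ioi_of_hasDerivAt_of_tendsto'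
    (fun t _ => hasDerivAt_neg_exp_neg_mul_sinh hx.ne' t)
    (integrableOn_exp_neg_mul_sinh_mul_cosh hx) (tendsto_neg_exp_neg_mul_sinh hx)]
  simp

theorem exp_neg_mul_cosh_le_exp_neg_mul_sinh {x : ℝ} (hx : 0 < x) (t : ℝ) :
    Real.exp (-x * Real.cosh t) ≤ Real.exp (-x * Real.sinh t) := by
  have := (Real.sinh_lt_cosh t).le
  exact Real.exp_le_exp.2 (by nlinarith)

theorem integrableOn_exp_neg_mul_cosh_mul_pow (n : ℕ) {x : ℝ} (hx : 0 < x) :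
    IntegrableOn (fun t => Real.exp (-x * Real.cosh t) * Real.cosh t ^ n) (Ioi 0) := by
  refine Integrable.mono'
    ((integrableOn_exp_neg_mul_sinh_mul_cosh (half_pos hx)).const_mul (n.factorial * (2 / x) ^ n))
    (by fun_prop) (Eventually.of_forall fun t => ?_)
  have hc := Real.one_le_cosh t
  rw [Real.norm_of_nonneg (by positivity)]
  have hpow : Real.cosh t ^ n ≤ n.factorial * (2 / x) ^ n * Real.exp (x / 2 * Real.cosh t) := by
    have h := Real.pow_div_factorial_le_exp (x / 2 * Real.cosh t) (by positivity) n
    rw [div_le_iff₀ (by positivity), mul_pow] at h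
    have h2 : (2 / x) ^ n * (x / 2) ^ n = 1 := by
      rw [← mul_pow]; field_simp; simp
    calc Real.cosh t ^ n = (2 / x) ^ n * ((x / 2) ^ n * Real.cosh t ^ n) := by
          rw [← mul_assoc, h2, one_mul]
      _ ≤ (2 / x) ^ n * (Real.exp (x / 2 * Real.cosh t) * n.factorial) := by gcongr
      _ = _ := by ring
  calc Real.exp (-x * Real.cosh t) * Real.cosh t ^ n
      ≤ Real.exp (-x * Real.cosh t)
          * (n.factorial * (2 / x) ^ n * Real.exp (x / 2 * Real.cosh t)) := by gcongr
    _ = n.factorial * (2 / x) ^ n * Real.exp (-(x / 2) * Real.cosh t) := by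
        rw [show -(x / 2) * Real.cosh t = -x * Real.cosh t + x / 2 * Real.cosh t by ring,
          Real.exp_add]
        ring
    _ ≤ n.factorial * (2 / x) ^ n * (Real.exp (-(x / 2) * Real.sinh t) * Real.cosh t) := by
        gcongr
        exact (exp_neg_mul_cosh_le_exp_neg_mul_sinh (half_pos hx) t).trans
          (le_mul_of_one_le_right (Real.exp_pos _).le hc)

theorem hasDerivAt_coshMoment (n : ℕ) {x : ℝ} (hx : 0 < x) :
    HasDerivAt (coshMoment n) (-coshMoment (n + 1) x) x := by
  have h := (hasDerivAt_integral_of_dominated_loc_of_deriv_le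
    (μ := volume.restrict (Ioi (0 : ℝ)))
    (F := fun y t => Real.exp (-y * Real.cosh t) * Real.cosh t ^ n)
    (F' := fun y t => -(Real.exp (-y * Real.cosh t) * Real.cosh t ^ (n + 1)))
    (bound := fun t => Real.exp (-(x / 2) * Real.cosh t) * Real.cosh t ^ (n + 1))
    (x₀ := x) (Ioi_mem_nhds (half_lt_self hx))
    (Eventually.of_forall fun y => by fun_prop)
    (integrableOn_exp_neg_mul_cosh_mul_pow n hx)
    (by fun_prop)
    (Eventually.of_forall fun t y hy => ?_)
    (integrableOn_exp_neg_mul_cosh_mul_pow (n + 1) (half_pos hx))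
    (Eventually.of_forall fun t y _ => ?_)).2
  · rwa [integral_neg] at h
  · have hc := Real.cosh_pos t
    rw [norm_neg, Real.norm_of_nonneg (by positivity)]
    have hy' : x / 2 < y := hy
    gcongr
  · have h := (((hasDerivAt_id y).neg.mul_const (Real.cosh t)).exp).mul_const (Real.cosh t ^ n)
    refine h.congr_deriv ?_
    simp only [id, Pi.neg_apply]
    ring

theorem coshMoment_one_add {x : ℝ} (hx : 0 < x) :
    coshMoment 1 x + x * coshMoment 0 x = x * coshMoment 2 x := by
  have hi := fun n => integrableOn_exp_neg_mul_cosh_mul_pow n hx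
  have hlim : Tendsto (fun t => Real.sinh t * Real.exp (-x * Real.cosh t)) atTop (𝓝 0) := by
    have h0 := (Real.tendsto_pow_mul_exp_neg_atTop_nhds_zero 1).comp
      (tendsto_sinh_atTop.const_mul_atTop hx)
    have h1 : Tendsto (fun t => Real.sinh t * Real.exp (-x * Real.sinh t)) atTop (𝓝 0) := by
      have := h0.const_mul x⁻¹
      simp only [mul_zero] at this
      refine this.congr fun t => ?_
      simp only [Function.comp, pow_one]
      field_simp
    refine tendsto_of_tendsto_of_tendsto_of_le_of_le' tendsto_const_nhds h1
      ((eventually_ge_atTop 0).mono fun t ht => ?_) ((eventually_ge_atTop 0).mono fun t ht => ?_)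
    · exact mul_nonneg (Real.sinh_nonneg_iff.2 ht) (Real.exp_pos _).le
    · exact mul_le_mul_of_nonneg_left (exp_neg_mul_cosh_le_exp_neg_mul_sinh hx t)
        (Real.sinh_nonneg_iff.2 ht)
  have key := integral_Ioi_of_hasDerivAt_of_tendsto' (a := 0)
    (f := fun t => Real.sinh t * Real.exp (-x * Real.cosh t))
    (f' := fun t => Real.exp (-x * Real.cosh t) * Real.cosh t ^ 1
      + x * (Real.exp (-x * Real.cosh t) * Real.cosh t ^ 0)
      - x * (Real.exp (-x * Real.cosh t) * Real.cosh t ^ 2))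
    (fun t _ => by
      have h := (Real.hasDerivAt_sinh t).mul (((Real.hasDerivAt_cosh t).const_mul (-x)).exp)
      refine h.congr_deriv ?_
      rw [Real.cosh_sq t]
      ring)
    (((hi 1).add ((hi 0).const_mul x)).sub ((hi 2).const_mul x)) hlim
  have hadd : IntegrableOn (fun t => Real.exp (-x * Real.cosh t) * Real.cosh t ^ 1
      + x * (Real.exp (-x * Real.cosh t) * Real.cosh t ^ 0)) (Ioi 0) :=
    (hi 1).add ((hi 0).const_mul x)
  rw [integral_sub hadd ((hi 2).const_mul x), integral_add (hi 1) ((hi 0).const_mul x),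
    integral_const_mul, integral_const_mul] at key
  simp only [Real.sinh_zero, zero_mul, sub_zero] at key
  simp only [coshMoment]
  linarith

theorem hasDerivAt_K0 {x : ℝ} (hx : 0 < x) : HasDerivAt K0 (-K1 x) x := by
  rw [K0_eq_coshMoment, K1_eq_coshMoment]
  exact hasDerivAt_coshMoment 0 hx

theorem hasDerivAt_hatK1 {x : ℝ} (hx : 0 < x) : HasDerivAt hatK1 (-(x * K0 x)) x := by
  have h := (hasDerivAt_id x).mul (hasDerivAt_coshMoment 1 hx)
  have e : hatK1 = id * coshMoment 1 := by
    funext y; simp [hatK1, K1_eq_coshMoment]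
  rw [e, K0_eq_coshMoment]
  refine h.congr_deriv ?_
  have := coshMoment_one_add hx
  simp only [id]
  linarith

theorem mul_exp_le_K0 {x T : ℝ} (hx : 0 < x) (hT : 0 ≤ T) :
    T * Real.exp (-x * Real.cosh T) ≤ K0 x := by
  have hi : IntegrableOn (fun t => Real.exp (-x * Real.cosh t)) (Ioi 0) := by
    simpa using integrableOn_exp_neg_mul_cosh_mul_pow 0 hx
  calc T * Real.exp (-x * Real.cosh T)
      = ∫ _ in Ioc (0 : ℝ) T, Real.exp (-x * Real.cosh T) := by
        simp [hT]
    _ ≤ ∫ t in Ioc (0 : ℝ) T, Real.exp (-x * Real.cosh t) := by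
        refine setIntegral_mono_on (by simp) (hi.mono_set Ioc_subset_Ioi_self)
          measurableSet_Ioc fun t ht => Real.exp_le_exp.2 ?_
        have : Real.cosh t ≤ Real.cosh T := by
          rw [Real.cosh_le_cosh, abs_of_pos ht.1, abs_of_nonneg hT]
          exact ht.2
        nlinarith
    _ ≤ K0 x := setIntegral_mono_set hi
        (Eventually.of_forall fun t => (Real.exp_pos _).le) Ioc_subset_Ioi_self.eventuallyLE

theorem K0_pos {x : ℝ} (hx : 0 < x) : 0 < K0 x :=
  lt_of_lt_of_le (by positivity) (mul_exp_le_K0 hx zero_le_one)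

theorem tendsto_K0_nhdsGT_zero : Tendsto K0 (𝓝[>] 0) atTop := by
  refine tendsto_atTop.2 fun A => ?_
  have hcont : Tendsto (fun x : ℝ => (|A| + 1) * Real.exp (-x * Real.cosh (|A| + 1)))
      (𝓝[>] 0) (𝓝 (|A| + 1)) := by
    have : Continuous fun x : ℝ => (|A| + 1) * Real.exp (-x * Real.cosh (|A| + 1)) := by fun_prop
    simpa using (this.tendsto 0).mono_left nhdsWithin_le_nhds
  filter_upwards [hcont.eventually (lt_mem_nhds (show A < |A| + 1 by linarith [le_abs_self A])),
    self_mem_nhdsWithin] with x hA hx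
  exact hA.le.trans (mul_exp_le_K0 hx (by positivity))

theorem K0_le_K1 {x : ℝ} (hx : 0 < x) : K0 x ≤ K1 x := by
  refine integral_mono (by simpa [IntegrableOn] using integrableOn_exp_neg_mul_cosh_mul_pow 0 hx)
    (by simpa [IntegrableOn] using integrableOn_exp_neg_mul_cosh_mul_pow 1 hx) fun t => ?_
  exact le_mul_of_one_le_right (Real.exp_pos _).le (Real.one_le_cosh t)

theorem K1_le_one_div {x : ℝ} (hx : 0 < x) : K1 x ≤ 1 / x := by
  rw [← integral_exp_neg_mul_sinh_mul_cosh hx]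
  refine integral_mono (by simpa [IntegrableOn] using integrableOn_exp_neg_mul_cosh_mul_pow 1 hx)
    (integrableOn_exp_neg_mul_sinh_mul_cosh hx) fun t => ?_
  exact mul_le_mul_of_nonneg_right (exp_neg_mul_cosh_le_exp_neg_mul_sinh hx t)
    (Real.cosh_pos t).le

theorem hatK1_le_one {x : ℝ} (hx : 0 < x) : hatK1 x ≤ 1 := by
  have h := K1_le_one_div hx
  rw [le_div_iff₀ hx] at h
  rw [hatK1]
  linarith

theorem hatK1_pos {x : ℝ} (hx : 0 < x) : 0 < hatK1 x :=
  mul_pos hx ((K0_pos hx).trans_le (K0_le_K1 hx))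

theorem continuousOn_K0 : ContinuousOn K0 (Ioi 0) :=
  fun _ hx => (hasDerivAt_K0 hx).continuousAt.continuousWithinAt

theorem continuousOn_hatK1 : ContinuousOn hatK1 (Ioi 0) :=
  fun _ hx => (hasDerivAt_hatK1 hx).continuousAt.continuousWithinAt

theorem continuousOn_hatK1_div_K0 : ContinuousOn (fun x => hatK1 x / K0 x) (Ioi 0) :=
  continuousOn_hatK1.div continuousOn_K0 fun _ hx => (K0_pos hx).ne'

theorem antitoneOn_K0 : AntitoneOn K0 (Ioi 0) := by
  refine antitoneOn_of_hasDerivWithinAt_nonpos (convex_Ioi 0) continuousOn_K0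
    (f' := fun x => -K1 x) ?_ ?_ <;> rw [interior_Ioi] <;> intro x hx
  · exact (hasDerivAt_K0 hx).hasDerivWithinAt
  · have := (K0_pos hx).trans_le (K0_le_K1 hx)
    linarith

theorem antitoneOn_hatK1 : AntitoneOn hatK1 (Ioi 0) := by
  refine antitoneOn_of_hasDerivWithinAt_nonpos (convex_Ioi 0) continuousOn_hatK1
    (f' := fun x => -(x * K0 x)) ?_ ?_ <;> rw [interior_Ioi] <;> intro x hx
  · exact (hasDerivAt_hatK1 hx).hasDerivWithinAt
  · have := mul_pos hx (K0_pos hx)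
    linarith

theorem monotoneOn_hatK1_div_K0 : MonotoneOn (fun x => hatK1 x / K0 x) (Ioi 0) := by
  refine monotoneOn_of_hasDerivWithinAt_nonneg (convex_Ioi 0) continuousOn_hatK1_div_K0
    (f' := fun x => (-(x * K0 x) * K0 x - hatK1 x * -K1 x) / K0 x ^ 2) ?_ ?_ <;>
    rw [interior_Ioi] <;> intro x (hx : 0 < x)
  · exact ((hasDerivAt_hatK1 hx).div (hasDerivAt_K0 hx) (K0_pos hx).ne').hasDerivWithinAt
  · have h0 := K0_pos hx
    have h01 := K0_le_K1 hx
    refine div_nonneg ?_ (by positivity)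
    rw [hatK1, show -(x * K0 x) * K0 x - x * K1 x * -K1 x
      = x * ((K1 x - K0 x) * (K1 x + K0 x)) by ring]
    exact mul_nonneg hx.le (mul_nonneg (by linarith) (by linarith))

theorem K0_sub_K0_le_log {y s : ℝ} (hy : 0 < y) (hs : y ≤ s) :
    K0 y - K0 s ≤ Real.log s - Real.log y := by
  have hd : ∀ x : ℝ, 0 < x → HasDerivAt (fun x => K0 x + Real.log x) (-K1 x + x⁻¹) x :=
    fun x hx => (hasDerivAt_K0 hx).add (Real.hasDerivAt_log hx.ne')
  have hmono : MonotoneOn (fun x => K0 x + Real.log x) (Ioi 0) := by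
    refine monotoneOn_of_hasDerivWithinAt_nonneg (convex_Ioi 0)
      (fun x hx => (hd x hx).continuousAt.continuousWithinAt)
      (f' := fun x => -K1 x + x⁻¹) ?_ ?_ <;> rw [interior_Ioi] <;> intro x hx
    · exact (hd x hx).hasDerivWithinAt
    · have := K1_le_one_div hx
      rw [one_div] at this
      linarith
  have := hmono hy (hy.trans_le hs) hs
  simp only at this
  linarith

theorem hatK1_div_K0_sub_le {y s : ℝ} (hy : 0 < y) (hs : y ≤ s) :
    hatK1 s / K0 s - hatK1 y / K0 y ≤ (Real.log s - Real.log y) / (K0 s * K0 y) := by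
  have hs0 := hy.trans_le hs
  have h1 := K0_pos hy
  have h2 := K0_pos hs0
  have hsub : 0 ≤ K0 y - K0 s := sub_nonneg.2 (antitoneOn_K0 hy hs0 hs)
  rw [div_sub_div _ _ h2.ne' h1.ne']
  refine div_le_div_of_nonneg_right ?_ (by positivity)
  calc hatK1 s * K0 y - K0 s * hatK1 y
      ≤ hatK1 y * K0 y - K0 s * hatK1 y := by
        gcongr
        exact antitoneOn_hatK1 hy hs0 hs
    _ = hatK1 y * (K0 y - K0 s) := by ring
    _ ≤ 1 * (K0 y - K0 s) := by gcongr; exact hatK1_le_one hy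
    _ ≤ _ := by rw [one_mul]; exact K0_sub_K0_le_log hy hs

/-- The integrand of the singular integral. -/
noncomputable def singularIntegrand (ε y : ℝ) : ℝ :=
  (1 / (K0 (Real.sqrt (ε + y ^ 2)) * (ε + y ^ 2)))
    * (hatK1 (Real.sqrt (ε + y ^ 2)) / K0 (Real.sqrt (ε + y ^ 2)) - hatK1 y / K0 y)
    * (y * K0 y ^ 2)

theorem le_sqrt_add_sq {ε y : ℝ} (hε : 0 < ε) : y ≤ √(ε + y ^ 2) :=
  Real.le_sqrt_of_sq_le (by linarith)

theorem singularIntegrand_nonneg {ε y : ℝ} (hε : 0 < ε) (hy : 0 < y) :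
    0 ≤ singularIntegrand ε y := by
  have hs : 0 < √(ε + y ^ 2) := by positivity
  have h1 := K0_pos hs
  have h2 := K0_pos hy
  have h3 := monotoneOn_hatK1_div_K0 hy hs (le_sqrt_add_sq hε)
  exact mul_nonneg (mul_nonneg (by positivity) (sub_nonneg.2 h3)) (by positivity)

theorem singularIntegrand_le {ε y : ℝ} (hε : 0 < ε) (hy : 0 < y) :
    singularIntegrand ε y ≤ y / (ε + y ^ 2) *
      ((Real.log √(ε + y ^ 2) - Real.log y) / K0 √(ε + y ^ 2)
        + ((Real.log √(ε + y ^ 2) - Real.log y) / K0 √(ε + y ^ 2)) ^ 2) := by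
  have hs : 0 < √(ε + y ^ 2) := by positivity
  have hle := le_sqrt_add_sq (y := y) hε
  have h1 := K0_pos hs
  have h2 := K0_pos hy
  have hd := hatK1_div_K0_sub_le hy hle
  have hK := K0_sub_K0_le_log hy hle
  have hL : 0 ≤ Real.log √(ε + y ^ 2) - Real.log y := sub_nonneg.2 (Real.log_le_log hy hle)
  rw [singularIntegrand]
  set s := √(ε + y ^ 2)
  set L := Real.log s - Real.log y
  have hE : 0 < ε + y ^ 2 := by positivity
  set E := ε + y ^ 2
  calc 1 / (K0 s * E) * (hatK1 s / K0 s - hatK1 y / K0 y) * (y * K0 y ^ 2)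
      ≤ 1 / (K0 s * E) * (L / (K0 s * K0 y)) * (y * K0 y ^ 2) := by gcongr
    _ = y / E * (L / K0 s ^ 2) * K0 y := by field_simp
    _ ≤ y / E * (L / K0 s ^ 2) * (K0 s + L) := by gcongr; linarith
    _ = _ := by field_simp

theorem continuousOn_singularIntegrand {ε : ℝ} (hε : 0 < ε) :
    ContinuousOn (singularIntegrand ε) (Ioi 0) := by
  have hs : ContinuousOn (fun y => √(ε + y ^ 2)) (Ioi 0) := by fun_prop
  have hmaps : MapsTo (fun y => √(ε + y ^ 2)) (Ioi 0) (Ioi 0) := fun y _ => by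
    simp only [mem_Ioi]; positivity
  refine ((continuousOn_const.div ((continuousOn_K0.comp hs hmaps).mul (by fun_prop)) ?_).mul
    ((continuousOn_hatK1_div_K0.comp hs hmaps).sub continuousOn_hatK1_div_K0)).mul
    (continuousOn_id.mul (continuousOn_K0.pow 2))
  intro y hy
  have := K0_pos (hmaps hy)
  have : 0 < ε + y ^ 2 := by positivity
  exact (mul_pos ‹0 < K0 _› this).ne'

theorem log_sqrt_one_add_sq_sub_log_le {u : ℝ} (hu : 0 < u) :
    Real.log √(1 + u ^ 2) - Real.log u ≤ Real.log (1 + 1 / u) := by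
  rw [← Real.log_div (by positivity) hu.ne']
  refine Real.log_le_log (by positivity) ?_
  rw [div_le_iff₀ hu, Real.sqrt_le_iff]
  field_simp
  constructor <;> nlinarith

theorem log_one_add_le_two_mul_sqrt {z : ℝ} (hz : 0 ≤ z) : Real.log (1 + z) ≤ 2 * √z := by
  have h := Real.sqrt_nonneg z
  calc Real.log (1 + z) ≤ Real.log ((1 + √z) ^ 2) :=
        Real.log_le_log (by positivity) (by nlinarith [Real.sq_sqrt hz])
    _ = 2 * Real.log (1 + √z) := by rw [Real.log_pow]; norm_cast
    _ ≤ 2 * √z := by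
        have := Real.log_le_sub_one_of_pos (show 0 < 1 + √z by positivity)
        linarith

theorem sqrt_mul_singularIntegrand_le {ε u : ℝ} (hε : 0 < ε) (hu : 0 < u) :
    √ε * singularIntegrand ε (√ε * u) ≤ u / (1 + u ^ 2) *
      ((Real.log √(1 + u ^ 2) - Real.log u) / K0 (√ε * √(1 + u ^ 2))
        + ((Real.log √(1 + u ^ 2) - Real.log u) / K0 (√ε * √(1 + u ^ 2))) ^ 2) := by
  have hb : 0 < √ε := Real.sqrt_pos.2 hε
  have hE : ε + (√ε * u) ^ 2 = ε * (1 + u ^ 2) := by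
    rw [mul_pow, Real.sq_sqrt hε.le]; ring
  have hs : √(ε + (√ε * u) ^ 2) = √ε * √(1 + u ^ 2) := by
    rw [hE, Real.sqrt_mul hε.le]
  have h := mul_le_mul_of_nonneg_left (singularIntegrand_le hε (mul_pos hb hu)) hb.le
  rw [hs, hE, Real.log_mul hb.ne' (by positivity), Real.log_mul hb.ne' hu.ne',
    add_sub_add_left_eq_sub, ← mul_assoc] at h
  rwa [mul_div_assoc', ← mul_assoc, Real.mul_self_sqrt hε.le, mul_div_mul_left _ _ hε.ne'] at h

theorem setIntegral_singularIntegrand_eq {M ε : ℝ} (hε : 0 < ε) :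
    ∫ y in Ioc (0 : ℝ) M, singularIntegrand ε y =
      ∫ u in Ioi (0 : ℝ), {u | √ε * u ≤ M}.indicator
        (fun u => √ε * singularIntegrand ε (√ε * u)) u := by
  have hb : 0 < √ε := Real.sqrt_pos.2 hε
  have h := integral_comp_mul_left_Ioi ((Iic M).indicator (singularIntegrand ε)) 0 hb
  rw [mul_zero, setIntegral_indicator measurableSet_Iic, Ioi_inter_Iic, smul_eq_mul,
    eq_inv_mul_iff_mul_eq₀ hb.ne', ← integral_const_mul] at h
  rw [← h]
  congr 1
  funext u
  by_cases hu : √ε * u ≤ M <;> simp [indicator, hu]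

theorem tendsto_setIntegral_singularIntegrand (M : ℝ) :
    Tendsto (fun ε => ∫ y in Ioc (0 : ℝ) M, singularIntegrand ε y) (𝓝[>] 0) (𝓝 0) := by
  refine Tendsto.congr' (eventually_nhdsWithin_of_forall fun ε hε =>
    (setIntegral_singularIntegrand_eq hε).symm) ?_
  set k := K0 √(1 + M ^ 2)
  have hk : 0 < k := K0_pos (by positivity)
  suffices h : Tendsto (fun ε => ∫ u in Ioi (0 : ℝ), {u | √ε * u ≤ M}.indicator
      (fun u => √ε * singularIntegrand ε (√ε * u)) u) (𝓝[>] 0)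
      (𝓝 (∫ _ in Ioi (0 : ℝ), (0 : ℝ))) by
    rwa [integral_zero] at h
  have hmem : ∀ᶠ ε : ℝ in 𝓝[>] 0, ε ∈ Ioc (0 : ℝ) 1 := Ioc_mem_nhdsGT one_pos
  refine tendsto_integral_filter_of_dominated_convergence (l := 𝓝[>] (0 : ℝ))
    (fun u : ℝ => (1 / k + 4 / k ^ 2) * (1 + u ^ 2)⁻¹) ?_ ?_ ?_ ?_
  · filter_upwards [hmem] with ε hε
    have hb : 0 < √ε := Real.sqrt_pos.2 hε.1
    refine AEStronglyMeasurable.indicator (ContinuousOn.aestronglyMeasurable ?_ measurableSet_Ioi)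
      (measurableSet_le (by fun_prop) (by fun_prop))
    exact continuousOn_const.mul ((continuousOn_singularIntegrand hε.1).comp (by fun_prop)
      fun u hu => mul_pos hb hu)
  · filter_upwards [hmem] with ε hε
    filter_upwards [ae_restrict_mem measurableSet_Ioi] with u (hu : 0 < u)
    have hb : 0 < √ε := Real.sqrt_pos.2 hε.1
    by_cases hM : √ε * u ≤ M
    swap
    · rw [indicator_of_notMem (by simpa using hM), norm_zero]
      positivity
    rw [indicator_of_mem (show u ∈ {u | √ε * u ≤ M} from hM), Real.norm_of_nonneg
      (mul_nonneg hb.le (singularIntegrand_nonneg hε.1 (mul_pos hb hu)))]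
    refine (sqrt_mul_singularIntegrand_le hε.1 hu).trans ?_
    have hl0 : 0 ≤ Real.log √(1 + u ^ 2) - Real.log u :=
      sub_nonneg.2 (Real.log_le_log hu (le_sqrt_add_sq one_pos))
    have hl := log_sqrt_one_add_sq_sub_log_le hu
    have hl1 : Real.log √(1 + u ^ 2) - Real.log u ≤ 1 / u := by
      have := Real.log_le_sub_one_of_pos (show 0 < 1 + 1 / u by positivity)
      linarith
    have hl2 := hl.trans (log_one_add_le_two_mul_sqrt (one_div_pos.2 hu).le)
    set l := Real.log √(1 + u ^ 2) - Real.log u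
    have hkle : k ≤ K0 (√ε * √(1 + u ^ 2)) := by
      refine antitoneOn_K0 (mul_pos hb (by positivity) : (0 : ℝ) < _)
        (show (0 : ℝ) < √(1 + M ^ 2) by positivity) ?_
      rw [← Real.sqrt_mul hε.1.le]
      refine Real.sqrt_le_sqrt ?_
      have h1 : (√ε * u) ^ 2 ≤ M ^ 2 := pow_le_pow_left₀ (by positivity) hM 2
      rw [mul_pow, Real.sq_sqrt hε.1.le] at h1
      linarith [hε.2]
    have hq : l ^ 2 ≤ 4 / u := by
      calc l ^ 2 ≤ (2 * √(1 / u)) ^ 2 := pow_le_pow_left₀ hl0 hl2 2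
        _ = 4 / u := by rw [mul_pow, Real.sq_sqrt (by positivity)]; ring
    calc u / (1 + u ^ 2) * (l / K0 (√ε * √(1 + u ^ 2)) + (l / K0 (√ε * √(1 + u ^ 2))) ^ 2)
        ≤ u / (1 + u ^ 2) * (l / k + (l / k) ^ 2) := by
          have := div_nonneg hl0 (hk.trans_le hkle).le
          gcongr
      _ = u / (1 + u ^ 2) * (l / k + l ^ 2 / k ^ 2) := by rw [div_pow]
      _ ≤ u / (1 + u ^ 2) * (1 / u / k + 4 / u / k ^ 2) := by gcongr
      _ = _ := by field_simp
  · exact (integrable_inv_one_add_sq.const_mul _).integrableOn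
  · filter_upwards [ae_restrict_mem measurableSet_Ioi] with u (hu : 0 < u)
    have hr : 0 < √(1 + u ^ 2) := by positivity
    have harg : Tendsto (fun ε : ℝ => √ε * √(1 + u ^ 2)) (𝓝[>] 0) (𝓝[>] 0) := by
      refine tendsto_nhdsWithin_iff.2 ⟨?_, eventually_nhdsWithin_of_forall fun ε hε =>
        mul_pos (Real.sqrt_pos.2 hε) hr⟩
      have : Continuous fun ε : ℝ => √ε * √(1 + u ^ 2) := by fun_prop
      simpa using (this.tendsto 0).mono_left nhdsWithin_le_nhds
    have hdiv := (tendsto_K0_nhdsGT_zero.comp harg).const_div_atTop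
      (Real.log √(1 + u ^ 2) - Real.log u)
    have hlim := (hdiv.add (hdiv.pow 2)).const_mul (u / (1 + u ^ 2))
    simp only [ne_eq, OfNat.ofNat_ne_zero, not_false_eq_true, zero_pow, add_zero, mul_zero] at hlim
    refine tendsto_of_tendsto_of_tendsto_of_le_of_le' tendsto_const_nhds hlim
      (eventually_nhdsWithin_of_forall fun ε hε => ?_)
      (eventually_nhdsWithin_of_forall fun ε hε => ?_)
    · exact indicator_apply_nonneg fun _ =>
        mul_nonneg (Real.sqrt_nonneg _)
          (singularIntegrand_nonneg hε (mul_pos (Real.sqrt_pos.2 hε) hu))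
    · exact (indicator_le_self' (fun _ _ => mul_nonneg (Real.sqrt_nonneg _)
        (singularIntegrand_nonneg hε (mul_pos (Real.sqrt_pos.2 hε) hu))) u).trans
        (sqrt_mul_singularIntegrand_le hε hu)

/-- Assertion (5.47) of Lemma 5.8: the singular integral
`∫₀^M [1/(K₀(√(ε+y²))(ε+y²))] (K̂₁/K₀(√(ε+y²)) − K̂₁/K₀(y)) y K₀(y)² dy`
is nonnegative and converges to `0` as `ε → 0+`. -/
theorem singular_integral_vanishes_I (M : ℝ) (hM : 0 < M) :
    (∀ ε : ℝ, 0 < ε →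
      0 ≤ ∫ y in Set.Ioc (0 : ℝ) M,
        (1 / (K0 (Real.sqrt (ε + y ^ 2)) * (ε + y ^ 2)))
          * (hatK1 (Real.sqrt (ε + y ^ 2)) / K0 (Real.sqrt (ε + y ^ 2))
              - hatK1 y / K0 y)
          * (y * K0 y ^ 2)) ∧
    Tendsto
      (fun ε : ℝ => ∫ y in Set.Ioc (0 : ℝ) M,
        (1 / (K0 (Real.sqrt (ε + y ^ 2)) * (ε + y ^ 2)))
          * (hatK1 (Real.sqrt (ε + y ^ 2)) / K0 (Real.sqrt (ε + y ^ 2))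
              - hatK1 y / K0 y)
          * (y * K0 y ^ 2))
      (nhdsWithin 0 (Set.Ioi 0)) (nhds 0) := by
  exact ⟨fun ε hε => setIntegral_nonneg measurableSet_Ioc fun y hy =>
    singularIntegrand_nonneg hε hy.1, tendsto_setIntegral_singularIntegrand M⟩
end

section
/- Let E be a finite index set, w : E → [0,∞), β : E → (0,∞), and fix i ∈ E with w_i > 0. Let (z_n^j)_{n≥1} ⊂ ℂ \ {0} for each j ∈ E be sequences with z_n^j → z_∞^j ∈ ℂ as n → ∞, with z_∞^i = 0, and suppose that for every j ∈ E with w_j > 0 and z_∞^j = 0 the limit c_j := lim_{n→∞} (log |z_n^j|)/(log |z_n^i|) exists in ℝ. Then lim_{n→∞} [ ∑_{j ∈ E} w_j K₀(√(2β_j) |z_n^j|) ] / [ w_i K₀(√(2β_i) |z_n^i|) ] = ∑ { (w_j/w_i) · c_j : j ∈ E, w_j > 0, z_∞^j = 0 }. -/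
open MeasureTheory Filter Set Topology

lemma exp_neg_mul_cosh_le {x : ℝ} (hx : 0 < x) (t : ℝ) :
    Real.exp (-x * Real.cosh t) ≤ Real.exp (-x * t) := by
  rw [Real.exp_le_exp]
  have h1 : t ≤ Real.cosh t := by
    rcases le_total 0 t with ht | ht
    · exact (Real.self_le_sinh_iff.2 ht).trans (Real.sinh_lt_cosh t).le
    · exact ht.trans (Real.cosh_pos t).le
  nlinarith

lemma integrableOn_exp_neg_mul_cosh {x : ℝ} (hx : 0 < x) (a : ℝ) :
    IntegrableOn (fun t => Real.exp (-x * Real.cosh t)) (Ioi a) := by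
  refine Integrable.mono' (integrableOn_exp_mul_Ioi (neg_lt_zero.2 hx) a)
    (by fun_prop) (ae_of_all _ fun t => ?_)
  rw [Real.norm_eq_abs, abs_of_pos (Real.exp_pos _)]
  exact exp_neg_mul_cosh_le hx t

lemma K0_nonneg (x : ℝ) : 0 ≤ K0 x :=
  integral_nonneg fun _ => (Real.exp_pos _).le

lemma K0_le_inv {x : ℝ} (hx : 0 < x) : K0 x ≤ x⁻¹ := by
  have h := integral_mono (integrableOn_exp_neg_mul_cosh hx 0)
    (integrableOn_exp_mul_Ioi (neg_lt_zero.2 hx) 0) (exp_neg_mul_cosh_le hx)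
  rw [integral_exp_mul_Ioi (neg_lt_zero.2 hx) 0] at h
  simpa [K0, neg_div_neg_eq] using h

lemma K0_eq_add {x T : ℝ} (hx : 0 < x) (hT : 0 ≤ T) :
    K0 x = (∫ t in (0 : ℝ)..T, Real.exp (-x * Real.cosh t))
      + ∫ t in Ioi T, Real.exp (-x * Real.cosh t) := by
  rw [intervalIntegral.integral_of_le hT, K0, ← Ioc_union_Ioi_eq_Ioi hT]
  exact setIntegral_union Ioc_disjoint_Ioi_same measurableSet_Ioi
    ((integrableOn_exp_neg_mul_cosh hx 0).mono_set Ioc_subset_Ioi_self)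
    (integrableOn_exp_neg_mul_cosh hx T)

lemma neg_log_sub_one_le_K0 {x : ℝ} (hx : 0 < x) (hx1 : x ≤ 1) :
    -Real.log x - 1 ≤ K0 x := by
  have hT : 0 ≤ -Real.log x := neg_nonneg.2 (Real.log_nonpos hx.le hx1)
  have hmono : ∫ t in (0 : ℝ)..(-Real.log x), (1 - x * Real.exp t)
      ≤ ∫ t in (0 : ℝ)..(-Real.log x), Real.exp (-x * Real.cosh t) := by
    refine intervalIntegral.integral_mono_on hT
      (Continuous.intervalIntegrable (by fun_prop) _ _)
      (Continuous.intervalIntegrable (by fun_prop) _ _) fun t ht => ?_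
    have h1 := Real.add_one_le_exp (-x * Real.cosh t)
    have h2 : Real.cosh t ≤ Real.exp t := by
      have := Real.exp_le_exp.2 (show -t ≤ t by linarith [ht.1])
      rw [Real.cosh_eq]; linarith
    nlinarith
  have hval : ∫ t in (0 : ℝ)..(-Real.log x), (1 - x * Real.exp t)
      = -Real.log x - (1 - x) := by
    rw [intervalIntegral.integral_sub (Continuous.intervalIntegrable (by fun_prop) _ _)
      (Continuous.intervalIntegrable (by fun_prop) _ _),
      intervalIntegral.integral_const_mul, integral_exp, Real.exp_neg, Real.exp_log hx]
    simp [mul_sub, hx.ne']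
  have htail : 0 ≤ ∫ t in Ioi (-Real.log x), Real.exp (-x * Real.cosh t) :=
    integral_nonneg fun _ => (Real.exp_pos _).le
  rw [K0_eq_add hx hT]
  linarith

lemma K0_le_neg_log_add_two {x : ℝ} (hx : 0 < x) (hx1 : x ≤ 1) :
    K0 x ≤ -Real.log x + 2 := by
  have hT : 0 ≤ -Real.log x := neg_nonneg.2 (Real.log_nonpos hx.le hx1)
  have hhead : ∫ t in (0 : ℝ)..(-Real.log x), Real.exp (-x * Real.cosh t)
      ≤ ∫ _ in (0 : ℝ)..(-Real.log x), (1 : ℝ) := by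
    refine intervalIntegral.integral_mono_on hT
      (Continuous.intervalIntegrable (by fun_prop) _ _)
      (Continuous.intervalIntegrable (by fun_prop) _ _) fun t _ => ?_
    rw [Real.exp_le_one_iff]
    nlinarith [Real.cosh_pos t]
  have hneg : (-(1 / 2) : ℝ) < 0 := by norm_num
  have hint := integrableOn_exp_mul_Ioi hneg (-Real.log x)
  have htail : ∫ t in Ioi (-Real.log x), Real.exp (-x * Real.cosh t)
      ≤ ∫ t in Ioi (-Real.log x), Real.exp (-(1 / 2) * Real.log x) * Real.exp (-(1 / 2) * t) := by
    refine integral_mono (integrableOn_exp_neg_mul_cosh hx _) (hint.const_mul _) fun t => ?_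
    simp only
    rw [← Real.exp_add, Real.exp_le_exp]
    have h1 : Real.log x + t + 1 ≤ x * Real.exp t := by
      have := Real.add_one_le_exp (Real.log x + t)
      rwa [Real.exp_add, Real.exp_log hx] at this
    have h2 : Real.exp t / 2 ≤ Real.cosh t := by
      rw [Real.cosh_eq]; linarith [Real.exp_pos (-t)]
    nlinarith
  have hval : ∫ t in Ioi (-Real.log x),
      Real.exp (-(1 / 2) * Real.log x) * Real.exp (-(1 / 2) * t) = 2 := by
    rw [integral_const_mul, integral_exp_mul_Ioi hneg, mul_div_assoc', mul_neg, ← Real.exp_add]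
    norm_num
  rw [intervalIntegral.integral_const] at hhead
  rw [K0_eq_add hx hT]
  simp only [smul_eq_mul, mul_one, sub_zero] at hhead
  linarith

lemma tendsto_K0_mul_div_log {a : ℝ} (ha : 0 < a) :
    Tendsto (fun r => K0 (a * r) / Real.log r) (𝓝[>] 0) (𝓝 (-1)) := by
  have hinv : Tendsto (fun r => (Real.log r)⁻¹) (𝓝[>] 0) (𝓝 0) :=
    Real.tendsto_log_nhdsGT_zero.inv_tendsto_atBot
  have hsmall : Tendsto (fun r => (Real.log r)⁻¹ * (K0 (a * r) + Real.log r)) (𝓝[>] 0) (𝓝 0) := by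
    refine hinv.zero_mul_isBoundedUnder_le ?_
    refine isBoundedUnder_of_eventually_le (a := 2 + |Real.log a|) ?_
    filter_upwards [Ioo_mem_nhdsGT (inv_pos.2 ha)] with r hr
    have har : 0 < a * r := mul_pos ha hr.1
    have har1 : a * r ≤ 1 := by
      have := mul_le_mul_of_nonneg_left hr.2.le ha.le
      rwa [mul_inv_cancel₀ ha.ne'] at this
    have hl := neg_log_sub_one_le_K0 har har1
    have hu := K0_le_neg_log_add_two har har1
    rw [Real.log_mul ha.ne' hr.1.ne'] at hl hu
    simp only [Function.comp, Real.norm_eq_abs]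
    rw [abs_le]
    constructor <;> linarith [le_abs_self (Real.log a), neg_abs_le (Real.log a)]
  have := hsmall.sub_const 1
  rw [zero_sub] at this
  refine this.congr' ?_
  filter_upwards [Real.tendsto_log_nhdsGT_zero.eventually_lt_atBot 0] with r hr
  field_simp [hr.ne]
  ring

/-- Remark 3.6 (2°)(a): removal of singularities in the ratio
`∑_j w_j K₀(√(2β_j)|z_n^j|) / (w_i K₀(√(2β_i)|z_n^i|))` along sequences
`z_n^j → z_∞^j` of nonzero complex numbers with `z_∞^i = 0`, assuming the
logarithmic ratios `log|z_n^j| / log|z_n^i|` converge for each `j` with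
`w_j > 0` and `z_∞^j = 0`. -/
theorem ratio_of_K0_sums_limit {ι : Type*} [Fintype ι]
    (β w : ι → ℝ) (hβ : ∀ j, 0 < β j) (hw : ∀ j, 0 ≤ w j)
    (i : ι) (hwi : 0 < w i)
    (z : ℕ → ι → ℂ) (zl : ι → ℂ) (c : ι → ℝ)
    (hz : ∀ n j, z n j ≠ 0)
    (hconv : ∀ j, Tendsto (fun n => z n j) atTop (nhds (zl j)))
    (hzi : zl i = 0)
    (hc : ∀ j, 0 < w j → zl j = 0 →
      Tendsto (fun n => Real.log ‖z n j‖ / Real.log ‖z n i‖) atTop (nhds (c j)))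
    [DecidablePred fun j => 0 < w j ∧ zl j = 0] :
    Tendsto
      (fun n => (∑ j, w j * K0 (Real.sqrt (2 * β j) * ‖z n j‖))
          / (w i * K0 (Real.sqrt (2 * β i) * ‖z n i‖)))
      atTop
      (nhds (∑ j ∈ Finset.univ.filter (fun j => 0 < w j ∧ zl j = 0),
        (w j / w i) * c j)) := by
  have hpos : ∀ n j, 0 < ‖z n j‖ := fun n j => norm_pos_iff.2 (hz n j)
  have hsqrt : ∀ j, 0 < Real.sqrt (2 * β j) := fun j =>
    Real.sqrt_pos.2 (mul_pos two_pos (hβ j))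
  have hnorm : ∀ j, zl j = 0 → Tendsto (fun n => ‖z n j‖) atTop (𝓝[>] 0) := fun j hj =>
    tendsto_nhdsWithin_iff.2 ⟨by simpa [hj] using (hconv j).norm,
      Eventually.of_forall fun n => hpos n j⟩
  have hlog : ∀ j, zl j = 0 → ∀ᶠ n in atTop, Real.log ‖z n j‖ ≠ 0 := fun j hj =>
    ((Real.tendsto_log_nhdsGT_zero.comp (hnorm j hj)).eventually_lt_atBot 0).mono
      fun _ h => h.ne
  have hinv : Tendsto (fun n => (Real.log ‖z n i‖)⁻¹) atTop (𝓝 0) :=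
    (Real.tendsto_log_nhdsGT_zero.comp (hnorm i hzi)).inv_tendsto_atBot
  have hterm : ∀ j, Tendsto
      (fun n => w j * K0 (Real.sqrt (2 * β j) * ‖z n j‖) / Real.log ‖z n i‖) atTop
      (𝓝 (if 0 < w j ∧ zl j = 0 then -(w j * c j) else 0)) := by
    intro j
    rcases (hw j).eq_or_lt with hwj | hwj
    · simp [← hwj]
    by_cases hj : zl j = 0
    · rw [if_pos ⟨hwj, hj⟩]
      have h := (((tendsto_K0_mul_div_log (hsqrt j)).comp (hnorm j hj)).mul
        (hc j hwj hj)).const_mul (w j)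
      rw [neg_one_mul, mul_neg] at h
      refine h.congr' ?_
      filter_upwards [hlog j hj] with n hn
      simp only [Function.comp]
      field_simp
    · rw [if_neg fun h => hj h.2]
      have hbound : Tendsto (fun n => (Real.sqrt (2 * β j) * ‖z n j‖)⁻¹) atTop
          (𝓝 (Real.sqrt (2 * β j) * ‖zl j‖)⁻¹) :=
        ((hconv j).norm.const_mul _).inv₀ (mul_pos (hsqrt j) (norm_pos_iff.2 hj)).ne'
      have hK : Tendsto (fun n => (Real.log ‖z n i‖)⁻¹ * K0 (Real.sqrt (2 * β j) * ‖z n j‖))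
          atTop (𝓝 0) := by
        refine hinv.zero_mul_isBoundedUnder_le (hbound.isBoundedUnder_le.mono_le ?_)
        refine Eventually.of_forall fun n => ?_
        simp only [Function.comp, Real.norm_eq_abs, abs_of_nonneg (K0_nonneg _)]
        exact K0_le_inv (mul_pos (hsqrt j) (hpos n j))
      have h := hK.const_mul (w j)
      rw [mul_zero] at h
      exact h.congr fun n => by ring
  have hden : Tendsto
      (fun n => w i * K0 (Real.sqrt (2 * β i) * ‖z n i‖) / Real.log ‖z n i‖) atTop
      (𝓝 (-w i)) := by
    have h := ((tendsto_K0_mul_div_log (hsqrt i)).comp (hnorm i hzi)).const_mul (w i)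
    rw [mul_neg_one] at h
    exact h.congr fun n => by simp only [Function.comp]; ring
  have h := (tendsto_finsetSum Finset.univ fun j _ => hterm j).div hden (neg_ne_zero.2 hwi.ne')
  have hlim : (∑ j, if 0 < w j ∧ zl j = 0 then -(w j * c j) else 0) / -w i
      = ∑ j ∈ Finset.univ.filter (fun j => 0 < w j ∧ zl j = 0), (w j / w i) * c j := by
    rw [← Finset.sum_filter, Finset.sum_div]
    refine Finset.sum_congr rfl fun j _ => ?_
    rw [neg_div_neg_eq]; ring
  rw [hlim] at h
  refine h.congr' ?_
  filter_upwards [hlog i hzi] with n hn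
  simp only [Pi.div_apply]
  rw [← Finset.sum_div, div_div_div_cancel_right₀ hn]
end
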